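/- arXiv:1606.09532 — 2 statements merged into one kernel-verified Lean document; each statement's English description precedes it below -/
import Mathlib

section
/- Let p ≥ 5 be a prime, d = (p−1)/2, g ≥ 3 an integer, c an integer with 0 ≤ c ≤ d−1, and ε ∈ {0,1}. Then the number of small admissible p-colorings of type (c,ε) of the lollipop tree G_g equals (1/2)·(D_g^{(2c)}(p) + (−1)^ε·δ_g^{(2c)}(p)); that is, |C_p(g,c,ε)| = (1/2)(D_g^{(2c)}(p) + (−1)^ε δ_g^{(2c)}(p)) as real numbers. -/
/-- Admissibility of a triple of colors meeting at a vertex: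
even sum, triangle inequalities, and sum at most `2p - 4`. -/
def AdmTriple (p i j k : ℕ) : Prop :=
  (i + j + k) % 2 = 0 ∧ i ≤ j + k ∧ j ≤ i + k ∧ k ≤ i + j ∧ i + j + k ≤ 2 * p - 4

/-- `(a, b, cc)` is a small admissible `p`-coloring of type `(c, ε)` of the lollipop
tree `G_g`.  The relevant indices are `a i`, `b i` for `1 ≤ i ≤ g` (the `i`-th stick
edge has color `2 * a i` and the `i`-th loop edge has color `a i + b i`) and `cc j`
for `1 ≤ j ≤ g - 2` (the colors of the internal edges of the spine). -/
def IsSmallAdmissible (p g c ε : ℕ) (a b cc : ℕ → ℕ) : Prop :=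
  -- (1) admissibility at the `g - 1` trivalent vertices of the spine:
  -- the triples `(2a_1, 2a_2, c_1)`, `(c_{j-1}, 2a_{j+1}, c_j)` for `2 ≤ j ≤ g-2`,
  -- and `(c_{g-2}, 2a_g, 2c)` are admissible
  (∀ j, 1 ≤ j → j ≤ g - 1 →
      AdmTriple p (if j = 1 then 2 * a 1 else cc (j - 1)) (2 * a (j + 1))
        (if j ≤ g - 2 then cc j else 2 * c)) ∧
  -- (2) admissibility at the trivalent vertex of each lollipop
  (∀ i, 1 ≤ i → i ≤ g → 2 * (a i + b i) + 2 * a i ≤ 2 * p - 4) ∧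
  -- (3) all colors are at most `p - 2`
  (∀ i, 1 ≤ i → i ≤ g → 2 * a i ≤ p - 2 ∧ a i + b i ≤ p - 2) ∧
  (∀ j, 1 ≤ j → j ≤ g - 2 → cc j ≤ p - 2) ∧
  2 * c ≤ p - 2 ∧
  -- (4) the coloring has type `(c, ε)`
  (c + ∑ i ∈ Finset.Icc 1 g, a i) ≡ ε [MOD 2] ∧
  -- (5) smallness
  (∀ i, 1 ≤ i → i ≤ g → a i + b i ≤ (p - 1) / 2 - 1)

/-- The Verlinde formula
`D_g^{(2c)}(p) = (p/4)^{g-1} · Σ_{j=1}^{d} sin(πj(2c+1)/p) · (sin(πj/p))^{1-2g}`. -/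
noncomputable def Dverl (g c p : ℕ) : ℝ :=
  ((p : ℝ) / 4) ^ (g - 1) *
    ∑ j ∈ Finset.Icc 1 ((p - 1) / 2),
      Real.sin (Real.pi * j * (2 * c + 1) / p) *
        Real.sin (Real.pi * j / p) ^ (1 - 2 * (g : ℤ))

/-- The companion formula
`δ_g^{(2c)}(p) = (-1)^c · (4^{1-g}/p) · Σ_{j=1}^{d} sin(πj(2c+1)/p) · sin(πj/p) · (cos(πj/p))^{-2g}`. -/
noncomputable def deltaVerl (g c p : ℕ) : ℝ :=
  (-1) ^ c * ((4 : ℝ) ^ (1 - (g : ℤ)) / p) *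
    ∑ j ∈ Finset.Icc 1 ((p - 1) / 2),
      Real.sin (Real.pi * j * (2 * c + 1) / p) * Real.sin (Real.pi * j / p) *
        Real.cos (Real.pi * j / p) ^ (-(2 * (g : ℤ)))

lemma aux_cos_sum (φ : ℝ) (n : ℕ) :
    2 * Real.sin φ * ∑ j ∈ Finset.Icc 1 n, Real.cos (2 * j * φ) =
      Real.sin ((2 * n + 1) * φ) - Real.sin φ := by
  induction n with
  | zero => simp
  | succ n ih =>
    rw [Finset.sum_Icc_succ_top (by omega), mul_add, ih]
    push_cast
    have h1 : (2 * ((n : ℝ) + 1) + 1) * φ = 2 * (n + 1) * φ + φ := by ring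
    have h2 : (2 * (n : ℝ) + 1) * φ = 2 * (n + 1) * φ - φ := by ring
    rw [h1, h2, Real.sin_add, Real.sin_sub]
    ring

lemma aux_sin_sum (θ : ℝ) (n : ℕ) :
    Real.sin θ * ∑ y ∈ Finset.range n, Real.sin ((2 * y + 1) * θ) = Real.sin (n * θ) ^ 2 := by
  induction n with
  | zero => simp
  | succ n ih =>
    rw [Finset.sum_range_succ, mul_add, ih]
    push_cast
    have h1 : (2 * (n : ℝ) + 1) * θ = n * θ + (n * θ + θ) := by ring
    have h2 : ((n : ℝ) + 1) * θ = n * θ + θ := by ring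
    rw [h1, h2, Real.sin_add, Real.sin_add, Real.cos_add]
    have e1 := Real.sin_sq_add_cos_sq θ
    have e2 := Real.sin_sq_add_cos_sq (n * θ)
    generalize Real.sin θ = s at *
    generalize Real.cos θ = t at *
    generalize Real.sin (n * θ) = S at *
    generalize Real.cos (n * θ) = T at *
    linear_combination (-S^2) * e1

lemma aux_sin_sum_alt (θ : ℝ) (n : ℕ) :
    2 * Real.cos θ * ∑ y ∈ Finset.range n, (-1) ^ y * Real.sin ((2 * y + 1) * θ) =
      -(-1) ^ n * Real.sin (2 * n * θ) := by
  induction n with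
  | zero => simp
  | succ n ih =>
    rw [Finset.sum_range_succ, mul_add, ih]
    push_cast
    have h1 : (2 * (n : ℝ)) * θ = (2 * n + 1) * θ - θ := by ring
    have h2 : 2 * ((n : ℝ) + 1) * θ = (2 * n + 1) * θ + θ := by ring
    rw [h1, h2, Real.sin_add, Real.sin_sub, pow_succ]
    ring

lemma aux_G_succ (f : ℕ → ℝ) (n : ℕ) :
    ∑ y ∈ Finset.range (n + 1), (((n + 1 : ℕ) : ℝ) - y) * f y =
      ∑ y ∈ Finset.range n, ((n : ℝ) - y) * f y + ∑ y ∈ Finset.range (n + 1), f y := by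
  have h : ∑ y ∈ Finset.range n, ((n : ℝ) - y) * f y =
      ∑ y ∈ Finset.range (n + 1), ((n : ℝ) - y) * f y := by
    rw [Finset.sum_range_succ]; simp
  rw [h, ← Finset.sum_add_distrib]
  apply Finset.sum_congr rfl
  intro y _
  push_cast
  ring

lemma aux_G (θ : ℝ) (n : ℕ) :
    4 * Real.sin θ ^ 2 * ∑ y ∈ Finset.range n, ((n : ℝ) - y) * Real.sin ((2 * y + 1) * θ) =
      (2 * n + 1) * Real.sin θ - Real.sin ((2 * n + 1) * θ) := by
  induction n with
  | zero => simp
  | succ n ih =>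
    rw [aux_G_succ (fun y => Real.sin ((2 * y + 1) * θ)), mul_add, ih]
    have h := aux_sin_sum θ (n + 1)
    have h' : 4 * Real.sin θ ^ 2 * ∑ y ∈ Finset.range (n + 1), Real.sin ((2 * y + 1) * θ) =
      4 * Real.sin θ * Real.sin ((n + 1 : ℕ) * θ) ^ 2 := by rw [← h]; ring
    rw [h']
    push_cast
    have h1 : (2 * (n : ℝ) + 1) * θ = 2 * ((n + 1) * θ) - θ := by ring
    have h2 : (2 * ((n : ℝ) + 1) + 1) * θ = 2 * ((n + 1) * θ) + θ := by ring
    rw [h1, h2, Real.sin_add, Real.sin_sub, Real.cos_two_mul, Real.cos_sq']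
    ring

lemma aux_G_alt (θ : ℝ) (n : ℕ) :
    4 * Real.cos θ ^ 2 * ∑ y ∈ Finset.range n,
        ((n : ℝ) - y) * ((-1) ^ y * Real.sin ((2 * y + 1) * θ)) =
      Real.sin θ - (-1) ^ n * Real.sin ((2 * n + 1) * θ) := by
  induction n with
  | zero => simp
  | succ n ih =>
    rw [aux_G_succ (fun y => (-1) ^ y * Real.sin ((2 * y + 1) * θ)), mul_add, ih]
    have h := aux_sin_sum_alt θ (n + 1)
    have h' : 4 * Real.cos θ ^ 2 * ∑ y ∈ Finset.range (n + 1),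
        (-1) ^ y * Real.sin ((2 * y + 1) * θ) =
      2 * Real.cos θ * (-(-1) ^ (n + 1) * Real.sin (2 * (n + 1 : ℕ) * θ)) := by rw [← h]; ring
    rw [h']
    push_cast
    have h1 : (2 * (n : ℝ) + 1) * θ = 2 * (n + 1) * θ - θ := by ring
    have h2 : (2 * ((n : ℝ) + 1) + 1) * θ = 2 * (n + 1) * θ + θ := by ring
    rw [h1, h2, Real.sin_add, Real.sin_sub, pow_succ]
    ring

/-- fusion rule -/
def FusN (d x y z : ℕ) : Prop := x ≤ y + z ∧ y ≤ x + z ∧ z ≤ x + y ∧ x + y + z < 2 * d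

instance (d x y z : ℕ) : Decidable (FusN d x y z) := by unfold FusN; infer_instance

lemma aux_tele (θ : ℝ) (l m : ℕ) (h : l ≤ m) :
    2 * Real.sin θ * ∑ x ∈ Finset.Ico l m, Real.sin ((2 * x + 1) * θ) =
      Real.cos (2 * l * θ) - Real.cos (2 * m * θ) := by
  induction m, h using Nat.le_induction with
  | base => simp
  | succ n hn ih =>
    rw [Finset.sum_Ico_succ_top hn, mul_add, ih]
    push_cast
    have h1 : 2 * (n : ℝ) * θ = (2 * n + 1) * θ - θ := by ring
    have h2 : 2 * ((n : ℝ) + 1) * θ = (2 * n + 1) * θ + θ := by ring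
    rw [h1, h2, Real.cos_add, Real.cos_sub]
    ring

lemma aux_fusion_le (d j y z : ℕ) (θ : ℝ) (hθ : (2 * d + 1) * θ = Real.pi * j)
    (hz : z < d) (hyz : y ≤ z) :
    Real.sin θ * ∑ x ∈ Finset.range d,
        (if FusN d x y z then Real.sin ((2 * x + 1) * θ) else 0) =
      Real.sin ((2 * y + 1) * θ) * Real.sin ((2 * z + 1) * θ) := by
  rw [← Finset.sum_filter]
  have hset : (Finset.range d).filter (fun x => FusN d x y z) =
      Finset.Ico (z - y) (min (y + z + 1) (2 * d - y - z)) := by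
    ext x
    rw [Finset.mem_filter, Finset.mem_range, Finset.mem_Ico]
    unfold FusN
    omega
  rw [hset]
  have ht := aux_tele θ (z - y) (min (y + z + 1) (2 * d - y - z)) (by omega)
  have hc : Real.cos (2 * (min (y + z + 1) (2 * d - y - z) : ℕ) * θ) =
      Real.cos (2 * (y + z + 1) * θ) := by
    rcases le_total (y + z + 1) (2 * d - y - z) with h | h
    · rw [min_eq_left h]; push_cast; rfl
    · rw [min_eq_right h]
      have : ((2 * d - y - z : ℕ) : ℝ) = 2 * d - y - z := by
        rw [Nat.cast_sub (by omega), Nat.cast_sub (by omega)]; push_cast; ring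
      rw [this]
      have h3 : 2 * (2 * (d : ℝ) - y - z) * θ = j * (2 * Real.pi) - 2 * (y + z + 1) * θ := by
        linear_combination 2 * hθ
      rw [h3, Real.cos_nat_mul_two_pi_sub]
  rw [hc] at ht
  rw [Nat.cast_sub hyz] at ht
  have h1 : 2 * ((z : ℝ) - y) * θ = (2 * z + 1) * θ - (2 * y + 1) * θ := by ring
  have h2 : 2 * ((y : ℝ) + z + 1) * θ = (2 * z + 1) * θ + (2 * y + 1) * θ := by ring
  rw [h1, h2, Real.cos_add, Real.cos_sub] at ht
  linear_combination ht / 2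

lemma aux_fusion (d j y z : ℕ) (θ : ℝ) (hθ : (2 * d + 1) * θ = Real.pi * j)
    (hy : y < d) (hz : z < d) :
    Real.sin θ * ∑ x ∈ Finset.range d,
        (if FusN d x y z then Real.sin ((2 * x + 1) * θ) else 0) =
      Real.sin ((2 * y + 1) * θ) * Real.sin ((2 * z + 1) * θ) := by
  rcases le_total y z with h | h
  · exact aux_fusion_le d j y z θ hθ hz h
  · rw [mul_comm (Real.sin ((2 * y + 1) * θ)), ← aux_fusion_le d j z y θ hθ hy h]
    have : ∀ x, FusN d x y z ↔ FusN d x z y := by intro x; unfold FusN; omega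
    simp only [this]

lemma aux_orth (d z : ℕ) (hz : z < d) :
    ∑ j ∈ Finset.Icc 1 d, Real.sin ((2 * z + 1) * (Real.pi * j / (2 * d + 1))) *
      Real.sin (Real.pi * j / (2 * d + 1)) = if z = 0 then (2 * d + 1 : ℝ) / 4 else 0 := by
  have hd : (0 : ℝ) < 2 * d + 1 := by positivity
  have key : ∀ m : ℕ, 0 < m → m ≤ d →
      ∑ j ∈ Finset.Icc 1 d, Real.cos (2 * j * (Real.pi * m / (2 * d + 1))) = -1 / 2 := by
    intro m hm hmd
    have h := aux_cos_sum (Real.pi * m / (2 * d + 1)) d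
    have h1 : (2 * (d : ℝ) + 1) * (Real.pi * m / (2 * d + 1)) = m * Real.pi := by
      field_simp
    rw [h1, Real.sin_nat_mul_pi] at h
    have hpos : 0 < Real.sin (Real.pi * m / (2 * d + 1)) := by
      apply Real.sin_pos_of_pos_of_lt_pi
      · have := Real.pi_pos
        have : (0 : ℝ) < m := by exact_mod_cast hm
        positivity
      · rw [div_lt_iff₀ hd]
        have : (m : ℝ) < 2 * d + 1 := by exact_mod_cast (by omega : m < 2 * d + 1)
        exact mul_lt_mul_of_pos_left this Real.pi_pos
    have : 2 * Real.sin (Real.pi * m / (2 * d + 1)) *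
      (∑ j ∈ Finset.Icc 1 d, Real.cos (2 * j * (Real.pi * m / (2 * d + 1))) + 1 / 2) = 0 := by
      rw [mul_add, h]; ring
    rcases mul_eq_zero.mp this with h | h
    · linarith
    · linarith
  have hterm : ∀ j : ℕ, Real.sin ((2 * z + 1) * (Real.pi * j / (2 * d + 1))) *
      Real.sin (Real.pi * j / (2 * d + 1)) =
      1 / 2 * Real.cos (2 * j * (Real.pi * z / (2 * d + 1))) -
      1 / 2 * Real.cos (2 * j * (Real.pi * (z + 1 : ℕ) / (2 * d + 1))) := by
    intro j
    have h1 : 2 * j * (Real.pi * z / (2 * d + 1)) =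
      (2 * z + 1) * (Real.pi * j / (2 * d + 1)) - Real.pi * j / (2 * d + 1) := by ring
    have h2 : 2 * j * (Real.pi * (z + 1 : ℕ) / (2 * d + 1)) =
      (2 * z + 1) * (Real.pi * j / (2 * d + 1)) + Real.pi * j / (2 * d + 1) := by
      push_cast; ring
    rw [h1, h2, Real.cos_add, Real.cos_sub]
    ring
  simp only [hterm]
  rw [Finset.sum_sub_distrib, ← Finset.mul_sum, ← Finset.mul_sum, key (z + 1) (by omega) (by omega)]
  split_ifs with h
  · subst h
    simp
    ring
  · rw [key z (by omega) (by omega)]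
    ring

/-- transfer recursion -/
noncomputable def vrec (d : ℕ) (s : ℝ) : ℕ → ℕ → ℝ
  | 0, z => if z = 0 then 1 else 0
  | k + 1, z => ∑ x ∈ Finset.range d, ∑ y ∈ Finset.range d,
      if FusN d x y z then ((d : ℝ) - y) * s ^ y * vrec d s k x else 0

lemma vrec_eq (d : ℕ) (s : ℝ) (W : ℕ → ℝ)
    (hW : ∀ j ∈ Finset.Icc 1 d, ∑ y ∈ Finset.range d,
      ((d : ℝ) - y) * (s ^ y * Real.sin ((2 * y + 1) * (Real.pi * j / (2 * d + 1)))) =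
        W j * Real.sin (Real.pi * j / (2 * d + 1)))
    (k z : ℕ) (hz : z < d) :
    vrec d s k z = 4 / (2 * d + 1) * ∑ j ∈ Finset.Icc 1 d,
      Real.sin ((2 * z + 1) * (Real.pi * j / (2 * d + 1))) *
      Real.sin (Real.pi * j / (2 * d + 1)) * W j ^ k := by
  have hd : (0 : ℝ) < 2 * d + 1 := by positivity
  induction k generalizing z with
  | zero =>
    simp only [pow_zero, mul_one, vrec]
    rw [aux_orth d z hz]
    split_ifs
    · field_simp
    · simp
  | succ k ih =>
    have step : vrec d s (k + 1) z = ∑ x ∈ Finset.range d, ∑ y ∈ Finset.range d,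
        ∑ j ∈ Finset.Icc 1 d, 4 / (2 * d + 1) * W j ^ k * (((d : ℝ) - y) * s ^ y) *
          (Real.sin (Real.pi * j / (2 * d + 1)) *
          (if FusN d x y z then Real.sin ((2 * x + 1) * (Real.pi * j / (2 * d + 1))) else 0)) := by
      rw [vrec]
      refine Finset.sum_congr rfl fun x hx => Finset.sum_congr rfl fun y _ => ?_
      split_ifs
      · rw [ih x (Finset.mem_range.mp hx), Finset.mul_sum, Finset.mul_sum]
        refine Finset.sum_congr rfl fun j _ => ?_
        ring
      · simp
    rw [step, Finset.sum_comm]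
    have step2 : ∀ y ∈ Finset.range d, (∑ x ∈ Finset.range d,
        ∑ j ∈ Finset.Icc 1 d, 4 / (2 * (d : ℝ) + 1) * W j ^ k * (((d : ℝ) - y) * s ^ y) *
          (Real.sin (Real.pi * j / (2 * d + 1)) *
          (if FusN d x y z then Real.sin ((2 * x + 1) * (Real.pi * j / (2 * d + 1))) else 0))) =
        ∑ j ∈ Finset.Icc 1 d, 4 / (2 * (d : ℝ) + 1) * W j ^ k * 
          Real.sin ((2 * z + 1) * (Real.pi * j / (2 * d + 1))) *
          (((d : ℝ) - y) * (s ^ y * Real.sin ((2 * y + 1) * (Real.pi * j / (2 * d + 1))))) := by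
      intro y hy
      rw [Finset.sum_comm]
      refine Finset.sum_congr rfl fun j _ => ?_
      rw [← Finset.mul_sum, ← Finset.mul_sum,
        aux_fusion d j y z _ (by field_simp) (Finset.mem_range.mp hy) hz]
      ring
    rw [Finset.sum_congr rfl step2, Finset.sum_comm, Finset.mul_sum]
    refine Finset.sum_congr rfl fun j hj => ?_
    rw [← Finset.mul_sum, hW j hj]
    ring

abbrev Trip := (ℕ → ℕ) × (ℕ → ℕ) × (ℕ → ℕ)

/-- normalized chain colorings -/
def ChainP (d k z : ℕ) (σ : Trip) : Prop :=
  (∀ j, j < k → FusN d (σ.2.2 j) (σ.1 j) (σ.2.2 (j + 1)) ∧ σ.1 j + σ.2.1 j < d) ∧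
  σ.2.2 0 = 0 ∧ σ.2.2 k = z ∧ (∀ j, k ≤ j → σ.1 j = 0 ∧ σ.2.1 j = 0) ∧
  (∀ j, k < j → σ.2.2 j = 0)

/-- extend a chain -/
def extJ (k z : ℕ) (q : (_ : ℕ × ℕ × ℕ) × Trip) : Trip :=
  (Function.update q.2.1 k q.1.2.1, Function.update q.2.2.1 k q.1.2.2,
    Function.update q.2.2.2 (k + 1) z)

/-- truncate a chain -/
def truncI (k : ℕ) (σ : Trip) : (_ : ℕ × ℕ × ℕ) × Trip :=
  ⟨(σ.2.2 k, σ.1 k, σ.2.1 k),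
   (Function.update σ.1 k 0, Function.update σ.2.1 k 0, Function.update σ.2.2 (k + 1) 0)⟩

lemma ext_trunc (d k z : ℕ) (σ : Trip) (h : ChainP d (k + 1) z σ) :
    extJ k z (truncI k σ) = σ := by
  obtain ⟨a, b, e⟩ := σ
  obtain ⟨-, -, h3, -, -⟩ := h
  simp only at h3
  simp [extJ, truncI, ← h3]

lemma trunc_ext (d k z : ℕ) (q : (_ : ℕ × ℕ × ℕ) × Trip) (h : ChainP d k q.1.1 q.2) :
    truncI k (extJ k z q) = q := by
  obtain ⟨⟨x, y, b'⟩, ⟨a, b, e⟩⟩ := q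
  obtain ⟨-, -, h3, h4, h5⟩ := h
  simp only at h3 h4 h5
  have ha := (h4 k le_rfl).1
  have hb := (h4 k le_rfl).2
  have he := h5 (k + 1) (by omega)
  have e1 : Function.update a k 0 = a := by rw [← ha]; simp
  have e2 : Function.update b k 0 = b := by rw [← hb]; simp
  have e3 : Function.update e (k + 1) 0 = e := by rw [← he]; simp
  simp [extJ, truncI, h3, e1, e2, e3]

/-- local data at the last vertex -/
def stepQ (d z : ℕ) : Finset (ℕ × ℕ × ℕ) :=
  (Finset.range d ×ˢ Finset.range d ×ˢ Finset.range d).filter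
    (fun q => FusN d q.1 q.2.1 z ∧ q.2.1 + q.2.2 < d)

open Classical in
/-- finset of chains -/
noncomputable def chainS (d : ℕ) : ℕ → ℕ → Finset Trip
  | 0, z => if z = 0 then {(0, 0, 0)} else ∅
  | k + 1, z => ((stepQ d z).sigma (fun q => chainS d k q.1)).image (extJ k z)

lemma chain_ext (d k z : ℕ) (q : (_ : ℕ × ℕ × ℕ) × Trip) (hq : q.1 ∈ stepQ d z)
    (h : ChainP d k q.1.1 q.2) : ChainP d (k + 1) z (extJ k z q) := by
  obtain ⟨⟨x, y, b'⟩, ⟨a, b, e⟩⟩ := q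
  obtain ⟨h1, h2, h3, h4, h5⟩ := h
  simp only [stepQ, Finset.mem_filter, Finset.mem_product, Finset.mem_range] at h1 h2 h3 h4 h5 hq
  refine ⟨?_, ?_, ?_, ?_, ?_⟩
  · intro j hj
    simp only [extJ]
    rcases Nat.lt_succ_iff_lt_or_eq.mp hj with hj | rfl
    · have := h1 j hj
      rw [Function.update_of_ne (by omega), Function.update_of_ne (by omega),
        Function.update_of_ne (by omega), Function.update_of_ne (by omega)]
      exact this
    · simp [h3, hq]
  · simp [extJ, h2]
  · simp [extJ]
  · intro j hj
    simp only [extJ]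
    rw [Function.update_of_ne (by omega), Function.update_of_ne (by omega)]
    exact h4 j (by omega)
  · intro j hj
    simp only [extJ]
    rw [Function.update_of_ne (by omega)]
    exact h5 j (by omega)

lemma chain_trunc (d k z : ℕ) (σ : Trip) (h : ChainP d (k + 1) z σ) :
    (truncI k σ).1 ∈ stepQ d z ∧ ChainP d k (truncI k σ).1.1 (truncI k σ).2 := by
  obtain ⟨a, b, e⟩ := σ
  obtain ⟨h1, h2, h3, h4, h5⟩ := h
  simp only at h1 h2 h3 h4 h5
  refine ⟨?_, ?_, ?_, ?_, ?_, ?_⟩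
  · have := h1 k (by omega)
    rw [h3] at this
    simp only [stepQ, truncI, Finset.mem_filter, Finset.mem_product, Finset.mem_range]
    unfold FusN at *
    omega
  · intro j hj
    simp only [truncI]
    rw [Function.update_of_ne (by omega), Function.update_of_ne (by omega),
        Function.update_of_ne (by omega), Function.update_of_ne (by omega)]
    exact h1 j (by omega)
  · simp [truncI, h2]
  · simp [truncI]
  · intro j hj
    simp only [truncI]
    rcases Nat.eq_or_lt_of_le hj with rfl | hj
    · simp
    · rw [Function.update_of_ne (by omega), Function.update_of_ne (by omega)]
      exact h4 j (by omega)
  · intro j hj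
    simp only [truncI]
    rcases Nat.eq_or_lt_of_le (Nat.succ_le_of_lt hj) with rfl | hj
    · simp
    · rw [Function.update_of_ne (by omega)]
      exact h5 j (by omega)

open Classical in
lemma mem_chainS (d k z : ℕ) (σ : Trip) : σ ∈ chainS d k z ↔ ChainP d k z σ := by
  induction k generalizing z σ with
  | zero =>
    obtain ⟨a, b, e⟩ := σ
    constructor
    · intro h
      rw [chainS] at h
      split_ifs at h with hz
      · simp only [Finset.mem_singleton, Prod.mk.injEq] at h
        obtain ⟨rfl, rfl, rfl⟩ := h
        simp [ChainP, hz]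
      · simp at h
    · rintro ⟨-, h2, h3, h4, h5⟩
      simp only at h2 h3 h4 h5
      have hz : z = 0 := by omega
      rw [chainS, if_pos hz]
      simp only [Finset.mem_singleton, Prod.mk.injEq]
      refine ⟨funext fun j => (h4 j (by omega)).1, funext fun j => (h4 j (by omega)).2,
        funext fun j => ?_⟩
      rcases Nat.eq_zero_or_pos j with rfl | hj
      · exact h2
      · exact h5 j hj
  | succ k ih =>
    rw [chainS, Finset.mem_image]
    constructor
    · rintro ⟨q, hq, rfl⟩
      rw [Finset.mem_sigma, ih] at hq
      exact chain_ext d k z q hq.1 hq.2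
    · intro h
      refine ⟨truncI k σ, ?_, ext_trunc d k z σ h⟩
      rw [Finset.mem_sigma, ih]
      exact chain_trunc d k z σ h

open Classical in
lemma chain_sum (d k z : ℕ) (s : ℝ) :
    ∑ σ ∈ chainS d k z, s ^ (∑ i ∈ Finset.range k, σ.1 i) = vrec d s k z := by
  induction k generalizing z with
  | zero =>
    rw [chainS, vrec]
    split_ifs <;> simp
  | succ k ih =>
    rw [chainS, Finset.sum_image, Finset.sum_sigma]
    · have h1 : ∀ q ∈ stepQ d z, ∑ τ ∈ chainS d k q.1,
          s ^ (∑ i ∈ Finset.range (k + 1), (extJ k z ⟨q, τ⟩).1 i) =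
          s ^ q.2.1 * vrec d s k q.1 := by
        intro q _
        rw [← ih, Finset.mul_sum]
        refine Finset.sum_congr rfl fun τ _ => ?_
        rw [Finset.sum_range_succ, pow_add, mul_comm]
        congr 2
        · simp [extJ]
        · refine Finset.sum_congr rfl fun i hi => ?_
          have := Finset.mem_range.mp hi
          simp only [extJ]
          rw [Function.update_of_ne (by omega)]
      rw [Finset.sum_congr rfl h1, stepQ, Finset.sum_filter, Finset.sum_product, vrec]
      refine Finset.sum_congr rfl fun x _ => ?_
      rw [Finset.sum_product]
      refine Finset.sum_congr rfl fun y hy => ?_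
      have hy := Finset.mem_range.mp hy
      simp only
      split_ifs with h
      · simp only [h, true_and]
        rw [← Finset.sum_filter]
        have : (Finset.range d).filter (fun b => y + b < d) = Finset.range (d - y) := by
          ext b; simp only [Finset.mem_filter, Finset.mem_range]; omega
        rw [this, Finset.sum_const, Finset.card_range, nsmul_eq_mul, Nat.cast_sub hy.le]
        ring
      · simp [h]
    · intro q hq q' hq' h
      rw [Finset.mem_coe, Finset.mem_sigma, mem_chainS] at hq hq'
      rw [← trunc_ext d k z q hq.2, ← trunc_ext d k z q' hq'.2, h]

/-- to chain -/
def toChain (g c : ℕ) (σ : Trip) : Trip :=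
  (fun i => σ.1 (i + 1), fun i => σ.2.1 (i + 1),
   fun j => if j = 0 then 0 else if j = 1 then σ.1 1 else if j < g then σ.2.2 (j - 1) / 2
     else if j = g then c else 0)

/-- from chain -/
def ofChain (g : ℕ) (σ : Trip) : Trip :=
  (fun i => if i = 0 then 0 else σ.1 (i - 1), fun i => if i = 0 then 0 else σ.2.1 (i - 1),
   fun j => if j = 0 ∨ g - 2 < j then 0 else 2 * σ.2.2 (j + 1))

/-- the original set -/
def OrigP (p g c ε : ℕ) (σ : Trip) : Prop :=
  IsSmallAdmissible p g c ε σ.1 σ.2.1 σ.2.2 ∧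
        (∀ i, i = 0 ∨ g < i → σ.1 i = 0 ∧ σ.2.1 i = 0) ∧
        (∀ j, j = 0 ∨ g - 2 < j → σ.2.2 j = 0)

lemma sum_shift (a : ℕ → ℕ) (g : ℕ) :
    ∑ i ∈ Finset.Icc 1 g, a i = ∑ i ∈ Finset.range g, a (i + 1) := by
  rw [Finset.range_eq_Ico, Finset.sum_Ico_add' a 0 g 1]
  rfl

lemma orig_even (p g c ε : ℕ) (σ : Trip) (h : OrigP p g c ε σ) :
    ∀ j, σ.2.2 j % 2 = 0 := by
  intro j
  induction j with
  | zero => rw [h.2.2 0 (Or.inl rfl)]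
  | succ j ih =>
    by_cases hj : j + 1 ≤ g - 2
    · have := (h.1.1 (j + 1) (by omega) (by omega)).1
      rw [if_pos hj] at this
      split_ifs at this with h1
      · omega
      · simp only [Nat.add_sub_cancel] at this
        omega
    · rw [h.2.2 (j + 1) (Or.inr (by omega))]

lemma toChain_mem (d g c ε : ℕ) (hg : 3 ≤ g) (hd : 2 ≤ d) (σ : Trip)
    (h : OrigP (2 * d + 1) g c ε σ) :
    ChainP d g c (toChain g c σ) ∧
      (c + ∑ i ∈ Finset.range g, (toChain g c σ).1 i) ≡ ε [MOD 2] := by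
  have hev := orig_even _ _ _ _ _ h
  obtain ⟨a, b, e⟩ := σ
  obtain ⟨⟨h1, h2, h3, h4, h5, h6, h7⟩, h8, h9⟩ := h
  simp only at h1 h2 h3 h4 h5 h6 h7 h8 h9 hev
  have hdd : (2 * d + 1 - 1) / 2 = d := by omega
  rw [hdd] at h7
  refine ⟨⟨?_, ?_, ?_, ?_, ?_⟩, ?_⟩
  · intro j hj
    have h7j := h7 (j + 1) (by omega) (by omega)
    refine ⟨?_, by simp only [toChain]; omega⟩
    rcases Nat.eq_zero_or_pos j with rfl | hj0
    · simp [toChain, FusN] at h7j ⊢; omega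
    have h1j := h1 j (by omega) (by omega)
    have e1 := hev (j - 1)
    have e2 := hev j
    simp only [toChain, FusN, AdmTriple, Nat.add_sub_cancel] at h1j ⊢
    have n1 : j ≠ 0 := by omega
    have n2 : j + 1 ≠ 0 := by omega
    have n3 : j + 1 ≠ 1 := by omega
    simp only [n1, n2, n3, hj, if_true, if_false] at h1j ⊢
    by_cases c1 : j = 1 <;> by_cases c2 : j ≤ g - 2
    · subst c1
      have n4 : 1 + 1 < g := by omega
      simp only [c2, n4, if_true] at h1j ⊢
      omega
    · omega
    · have n4 : j + 1 < g := by omega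
      simp only [c1, c2, n4, if_true, if_false] at h1j ⊢
      omega
    · have n4 : ¬ j + 1 < g := by omega
      have n5 : j + 1 = g := by omega
      simp only [c1, c2, n4, n5, if_true, if_false] at h1j ⊢
      simp only [lt_irrefl, if_false, ← n5]
      rw [← n5] at h1j
      omega
  · simp [toChain]
  · have n1 : g ≠ 0 := by omega
    have n2 : g ≠ 1 := by omega
    simp [toChain, n1, n2]
  · intro j hj
    exact h8 (j + 1) (Or.inr (by omega))
  · intro j hj
    simp only [toChain]
    rw [if_neg (by omega), if_neg (by omega), if_neg (by omega), if_neg (by omega)]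
  · simp only [toChain]
    rw [← sum_shift]
    exact h6

lemma ofChain_mem (d g c ε : ℕ) (hg : 3 ≤ g) (hd : 2 ≤ d) (σ : Trip)
    (h : ChainP d g c σ) (hpar : (c + ∑ i ∈ Finset.range g, σ.1 i) ≡ ε [MOD 2]) :
    OrigP (2 * d + 1) g c ε (ofChain g σ) := by
  obtain ⟨a, b, e⟩ := σ
  obtain ⟨h1, h2, h3, h4, h5⟩ := h
  simp only at h1 h2 h3 h4 h5 hpar
  have hdd : (2 * d + 1 - 1) / 2 = d := by omega
  have he1 : e 1 = a 0 := by
    have := (h1 0 (by omega)).1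
    unfold FusN at this
    simp only [h2, zero_add] at this
    omega
  have hA : ∀ i, 1 ≤ i → i ≤ g → a (i - 1) + b (i - 1) < d := by
    intro i hi hig
    exact (h1 (i - 1) (by omega)).2
  refine ⟨⟨?_, ?_, ?_, ?_, ?_, ?_, ?_⟩, ?_, ?_⟩
  · intro j hj1 hjg
    have h1j := (h1 j (by omega)).1
    simp only [ofChain, AdmTriple, FusN, Nat.add_sub_cancel] at h1j ⊢
    have n2 : j + 1 ≠ 0 := by omega
    simp only [n2, if_false]
    by_cases c1 : j = 1 <;> by_cases c2 : j ≤ g - 2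
    · subst c1
      have n4 : ¬ (1 = 0 ∨ g - 2 < 1) := by omega
      rw [if_pos rfl, if_pos c2, if_neg n4]
      simp only [if_false, one_ne_zero, Nat.sub_self]
      omega
    · omega
    · have n4 : ¬ (j = 0 ∨ g - 2 < j) := by omega
      have n5 : ¬ (j - 1 = 0 ∨ g - 2 < j - 1) := by omega
      have n6 : j - 1 + 1 = j := by omega
      simp only [c1, c2, n4, n5, n6, if_true, if_false]
      omega
    · have n5 : ¬ (j - 1 = 0 ∨ g - 2 < j - 1) := by omega
      have n6 : j - 1 + 1 = j := by omega
      have n7 : j + 1 = g := by omega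
      simp only [c1, c2, n5, n6, if_true, if_false]
      rw [n7, h3] at h1j
      omega
  · intro i hi hig
    have := hA i hi hig
    simp only [ofChain]
    rw [if_neg (by omega), if_neg (by omega)]
    omega
  · intro i hi hig
    have := hA i hi hig
    simp only [ofChain]
    rw [if_neg (by omega), if_neg (by omega)]
    omega
  · intro j hj hjg
    have := (h1 j (by omega)).1
    simp only [ofChain, FusN] at this ⊢
    rw [if_neg (by omega)]
    omega
  · have := (h1 (g - 1) (by omega)).1
    rw [show g - 1 + 1 = g by omega, h3] at this
    unfold FusN at this
    omega
  · rw [sum_shift]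
    simpa [ofChain] using hpar
  · intro i hi hig
    have := hA i hi hig
    simp only [ofChain]
    rw [if_neg (by omega), if_neg (by omega)]
    omega
  · intro i hi
    rcases hi with rfl | hi
    · simp [ofChain]
    · simp only [ofChain]
      rw [if_neg (by omega), if_neg (by omega)]
      exact h4 (i - 1) (by omega)
  · intro j hj
    simp only [ofChain]
    rw [if_pos hj]

lemma of_to (p g c ε : ℕ) (σ : Trip) (h : OrigP p g c ε σ) :
    ofChain g (toChain g c σ) = σ := by
  have hev := orig_even _ _ _ _ _ h
  obtain ⟨a, b, e⟩ := σ
  obtain ⟨-, h8, h9⟩ := h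
  simp only at h8 h9 hev
  simp only [ofChain, toChain, Prod.mk.injEq]
  refine ⟨funext fun i => ?_, funext fun i => ?_, funext fun j => ?_⟩
  · split_ifs with h
    · rw [h, (h8 0 (Or.inl rfl)).1]
    · rw [Nat.sub_add_cancel (by omega)]
  · split_ifs with h
    · rw [h, (h8 0 (Or.inl rfl)).2]
    · rw [Nat.sub_add_cancel (by omega)]
  · by_cases hj : j = 0 ∨ g - 2 < j
    · rw [if_pos hj, h9 j hj]
    · rw [if_neg hj, if_neg (by omega), if_neg (by omega), if_pos (by omega),
        Nat.add_sub_cancel]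
      have := hev j
      omega

lemma to_of (d g c : ℕ) (hg : 3 ≤ g) (σ : Trip) (h : ChainP d g c σ) :
    toChain g c (ofChain g σ) = σ := by
  obtain ⟨a, b, e⟩ := σ
  obtain ⟨h1, h2, h3, h4, h5⟩ := h
  simp only at h1 h2 h3 h4 h5
  have he1 : e 1 = a 0 := by
    have := (h1 0 (by omega)).1
    unfold FusN at this
    simp only [h2, zero_add] at this
    omega
  simp only [ofChain, toChain, Prod.mk.injEq]
  refine ⟨funext fun i => ?_, funext fun i => ?_, funext fun j => ?_⟩
  · simp
  · simp
  · by_cases c0 : j = 0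
    · rw [if_pos c0, c0, h2]
    rw [if_neg c0]
    by_cases c1 : j = 1
    · rw [if_pos c1, c1, he1]; simp
    rw [if_neg c1]
    by_cases c2 : j < g
    · rw [if_pos c2, if_neg (by omega), Nat.sub_add_cancel (by omega)]
      omega
    rw [if_neg c2]
    by_cases c3 : j = g
    · rw [if_pos c3, c3, h3]
    · rw [if_neg c3, h5 j (by omega)]

lemma orig_card (d g c ε : ℕ) (hg : 3 ≤ g) (hd : 2 ≤ d) (hε : ε ≤ 1) :
    (Nat.card {σ : Trip // OrigP (2 * d + 1) g c ε σ} : ℝ) =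
      1 / 2 * (vrec d 1 g c + (-1) ^ ε * ((-1) ^ c * vrec d (-1) g c)) := by
  have e : {σ : Trip // OrigP (2 * d + 1) g c ε σ} ≃
      {σ : Trip // σ ∈ (chainS d g c).filter
        (fun σ => (c + ∑ i ∈ Finset.range g, σ.1 i) ≡ ε [MOD 2])} :=
    { toFun := fun σ => ⟨toChain g c σ.1, by
        rw [Finset.mem_filter, mem_chainS]
        exact toChain_mem d g c ε hg hd σ.1 σ.2⟩
      invFun := fun σ => ⟨ofChain g σ.1, by
        have := σ.2
        rw [Finset.mem_filter, mem_chainS] at this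
        exact ofChain_mem d g c ε hg hd σ.1 this.1 this.2⟩
      left_inv := fun σ => Subtype.ext (of_to _ g c ε σ.1 σ.2)
      right_inv := fun σ => Subtype.ext (by
        have := σ.2
        rw [Finset.mem_filter, mem_chainS] at this
        exact to_of d g c hg σ.1 this.1) }
  rw [Nat.card_congr e, Nat.card_eq_fintype_card, Fintype.card_coe, ← chain_sum, ← chain_sum,
    Finset.card_eq_sum_ones, Finset.sum_filter, Nat.cast_sum, Finset.mul_sum, Finset.mul_sum,
    ← Finset.sum_add_distrib, Finset.mul_sum]
  refine Finset.sum_congr rfl fun σ _ => ?_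
  rw [one_pow, ← pow_add, ← pow_add]
  have hpow : ∀ n : ℕ, ((-1 : ℝ)) ^ n = if n % 2 = 0 then 1 else -1 := by
    intro n
    rcases Nat.even_or_odd n with h | h
    · rw [h.neg_one_pow, if_pos (Nat.even_iff.mp h)]
    · rw [h.neg_one_pow, if_neg (by rw [Nat.odd_iff.mp h]; norm_num)]
  rw [hpow]
  by_cases h : (c + ∑ i ∈ Finset.range g, σ.1 i) ≡ ε [MOD 2]
  · rw [if_pos h, if_pos (by unfold Nat.ModEq at h; omega)]; norm_num
  · rw [if_neg h, if_neg (by unfold Nat.ModEq at h; omega)]; norm_num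

/-- The number of small admissible `p`-colorings of type `(c, ε)` of the lollipop tree
`G_g` equals `(1/2)·(D_g^{(2c)}(p) + (-1)^ε·δ_g^{(2c)}(p))`.  A coloring is recorded as a
triple of functions `(a, b, cc)` vanishing outside the relevant ranges of indices. -/
theorem stmt0 (p d g c ε : ℕ) (hp : p.Prime) (hp5 : 5 ≤ p) (hd : d = (p - 1) / 2)
    (hg : 3 ≤ g) (hc : c ≤ d - 1) (hε : ε ≤ 1) :
    (Nat.card {σ : (ℕ → ℕ) × (ℕ → ℕ) × (ℕ → ℕ) //
        IsSmallAdmissible p g c ε σ.1 σ.2.1 σ.2.2 ∧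
        (∀ i, i = 0 ∨ g < i → σ.1 i = 0 ∧ σ.2.1 i = 0) ∧
        (∀ j, j = 0 ∨ g - 2 < j → σ.2.2 j = 0)} : ℝ) =
      1 / 2 * (Dverl g c p + (-1) ^ ε * deltaVerl g c p) := by
  have hodd : p % 2 = 1 := by
    rcases hp.eq_two_or_odd with h | h
    · omega
    · exact h
  have hpd : p = 2 * d + 1 := by omega
  clear hd
  subst hpd
  have hd2 : 2 ≤ d := by omega
  have hcd : c < d := by omega
  refine (orig_card d g c ε hg hd2 hε).trans ?_
  have hdd : (2 * d + 1 - 1) / 2 = d := by omega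
  have hdpos : (0 : ℝ) < 2 * d + 1 := by positivity
  have hθ : ∀ j ∈ Finset.Icc 1 d, 0 < Real.pi * j / (2 * d + 1) ∧
      Real.pi * j / (2 * d + 1) < Real.pi / 2 := by
    intro j hj
    rw [Finset.mem_Icc] at hj
    have h1 : (0 : ℝ) < j := by exact_mod_cast hj.1
    have h2 : (j : ℝ) ≤ d := by exact_mod_cast hj.2
    have hpi := Real.pi_pos
    refine ⟨by positivity, ?_⟩
    rw [div_lt_div_iff₀ hdpos (by norm_num)]
    nlinarith
  have hs : ∀ j ∈ Finset.Icc 1 d, Real.sin (Real.pi * j / (2 * d + 1)) ≠ 0 := by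
    intro j hj
    have := hθ j hj
    exact (Real.sin_pos_of_pos_of_lt_pi this.1 (by linarith [Real.pi_pos])).ne'
  have hcos : ∀ j ∈ Finset.Icc 1 d, Real.cos (Real.pi * j / (2 * d + 1)) ≠ 0 := by
    intro j hj
    have := hθ j hj
    exact (Real.cos_pos_of_mem_Ioo ⟨by linarith, this.2⟩).ne'
  have hsin0 : ∀ j : ℕ, Real.sin ((2 * d + 1) * (Real.pi * j / (2 * d + 1))) = 0 := by
    intro j
    rw [show (2 * (d : ℝ) + 1) * (Real.pi * j / (2 * d + 1)) = j * Real.pi by field_simp]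
    exact Real.sin_nat_mul_pi j
  have hD : vrec d 1 g c = Dverl g c (2 * d + 1) := by
    rw [vrec_eq d 1 (fun j => (2 * d + 1) / 4 / Real.sin (Real.pi * j / (2 * d + 1)) ^ 2)
      ?_ g c hcd]
    · rw [Dverl, hdd, Finset.mul_sum, Finset.mul_sum]
      refine Finset.sum_congr rfl fun j hj => ?_
      push_cast
      rw [show Real.pi * j * (2 * c + 1) / (2 * d + 1) =
        (2 * c + 1) * (Real.pi * j / (2 * d + 1)) by ring]
      have h0 := hs j hj
      rw [zpow_sub₀ h0, zpow_one, zpow_mul]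
      generalize Real.sin (Real.pi * j / (2 * d + 1)) = S at *
      obtain ⟨n, rfl⟩ : ∃ n, g = n + 1 := ⟨g - 1, by omega⟩
      rw [zpow_natCast, Nat.add_sub_cancel, div_pow _ (S ^ 2), pow_succ ((2 * (d : ℝ) + 1) / 4) n]
      norm_cast
      field_simp
    · intro j hj
      have h0 := hs j hj
      have h := aux_G (Real.pi * j / (2 * d + 1)) d
      rw [hsin0] at h
      simp only [one_pow, one_mul]
      generalize ∑ y ∈ Finset.range d, ((d : ℝ) - y) *
        Real.sin ((2 * y + 1) * (Real.pi * j / (2 * d + 1))) = A at *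
      generalize Real.sin (Real.pi * j / (2 * d + 1)) = S at *
      have h' : 4 * S * A = 2 * d + 1 := by
        apply mul_left_cancel₀ h0
        linear_combination h
      field_simp
      linear_combination h'
  have hδ : (-1) ^ c * vrec d (-1) g c = deltaVerl g c (2 * d + 1) := by
    rw [vrec_eq d (-1) (fun j => 1 / (4 * Real.cos (Real.pi * j / (2 * d + 1)) ^ 2))
      ?_ g c hcd]
    · rw [deltaVerl, hdd, mul_assoc]
      congr 1
      rw [Finset.mul_sum, Finset.mul_sum]
      refine Finset.sum_congr rfl fun j hj => ?_
      push_cast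
      rw [show Real.pi * j * (2 * c + 1) / (2 * d + 1) =
        (2 * c + 1) * (Real.pi * j / (2 * d + 1)) by ring]
      have h0 := hcos j hj
      rw [zpow_neg, zpow_mul, zpow_sub₀ (by norm_num), zpow_natCast, zpow_natCast, zpow_one]
      generalize Real.cos (Real.pi * j / (2 * d + 1)) = S at *
      rw [div_pow, mul_pow, one_pow]
      norm_cast
      field_simp
    · intro j hj
      have h0 := hcos j hj
      have h := aux_G_alt (Real.pi * j / (2 * d + 1)) d
      rw [hsin0] at h
      simp only [mul_zero, sub_zero] at h
      generalize ∑ y ∈ Finset.range d, ((d : ℝ) - y) *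
        ((-1) ^ y * Real.sin ((2 * y + 1) * (Real.pi * j / (2 * d + 1)))) = A at *
      rw [← h]
      field_simp
  rw [hD, hδ]
end

section
/- Let p ≥ 5 be a prime, d = (p−1)/2, g ≥ 3, and 1 ≤ c ≤ d−1. There is no small admissible p-coloring σ = (a_1,…,a_g, b_1,…,b_g, c_1,…,c_{g−2}) in C_p(g,c,1) such that d−1−a_i−2b_i ≡ d−1 (mod 2d) for all 1 ≤ i ≤ g−1 and d−1−a_g−2b_g ≡ d−c−2 (mod 2d). -/
/-- There is no small admissible `p`-coloring of type `(c, 1)` whose weight is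
congruent (mod `2d`) to `d - 1` in coordinates `1, …, g-1` and to `d - c - 2` in
coordinate `g`. -/
theorem stmt11 (p d g c : ℕ) (hp : p.Prime) (hp5 : 5 ≤ p) (hd : d = (p - 1) / 2)
    (hg : 3 ≤ g) (hc1 : 1 ≤ c) (hc : c ≤ d - 1) :
    ¬ ∃ a b cc : ℕ → ℕ, IsSmallAdmissible p g c 1 a b cc ∧
      (∀ i, 1 ≤ i → i ≤ g - 1 →
        (d : ℤ) - 1 - a i - 2 * b i ≡ (d : ℤ) - 1 [ZMOD 2 * (d : ℤ)]) ∧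
      (d : ℤ) - 1 - a g - 2 * b g ≡ (d : ℤ) - c - 2 [ZMOD 2 * (d : ℤ)] := by
  rintro ⟨a, b, cc, ⟨h1, -, -, -, -, -, h5⟩, hw, hwg⟩
  have ha : ∀ i, 1 ≤ i → i ≤ g - 1 → a i = 0 := by
    intro i hi hi'
    obtain ⟨k, hk⟩ := (hw i hi hi').dvd
    have h := h5 i hi (by omega)
    have hs : (a i : ℤ) + 2 * b i < 2 * d := by omega
    have hk1 : (a i : ℤ) + 2 * b i = 2 * d * k := by linarith
    have hk0 : k < 1 := by
      by_contra hcon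
      push Not at hcon
      nlinarith
    have : (2 * d : ℤ) * k ≤ 0 := by
      apply mul_nonpos_of_nonneg_of_nonpos <;> omega
    omega
  have hcc : ∀ j, 1 ≤ j → j ≤ g - 2 → cc j = 0 := by
    intro j hj
    induction j, hj using Nat.le_induction with
    | base =>
      intro hj'
      have h := h1 1 le_rfl (by omega)
      have e1 := ha 1 le_rfl (by omega)
      have e2 := ha 2 (by omega) (by omega)
      rw [if_pos rfl, if_pos hj'] at h
      obtain ⟨_, _, _, h4, _⟩ := h
      norm_num [e1, e2] at h4
      exact h4
    | succ j hj ih =>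
      intro hj'
      have h := h1 (j + 1) (by omega) (by omega)
      have e1 := ih (by omega)
      have e2 := ha (j + 1 + 1) (by omega) (by omega)
      rw [if_neg (by omega), if_pos hj'] at h
      obtain ⟨_, _, _, h4, _⟩ := h
      simp only [Nat.add_sub_cancel, e1, e2] at h4
      omega
  have h := h1 (g - 1) (by omega) le_rfl
  rw [if_neg (by omega), if_neg (by omega), Nat.sub_sub, hcc (g - (1 + 1)) (by omega) (by omega),
    Nat.sub_add_cancel (by omega)] at h
  obtain ⟨_, _, h3, h4, _⟩ := h
  have hag : a g = c := by omega
  obtain ⟨k, hk⟩ := hwg.dvd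
  rw [mul_assoc] at hk
  omega
end
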